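/- arXiv:2410.17674 — 2 statements merged into one kernel-verified Lean document; each statement's English description precedes it below -/
import Mathlib

section
/- For all integers n ≥ 1, r ≥ 2 and s ≥ 1, setting k = rs, one has s(16kn + 4k + 2) ≠ 8kn² + 8kn + 5k + n and s(16kn + 4k + 2) ≠ 8kn² + 4kn − 3k + n + 1. -/
/-- A positive multiple of `8nk + 2k + 1` exceeds `6n + 5` as soon as `k ≥ 2`. -/
theorem mul_ne_six_mul_add_five {n k : ℤ} (hn : 1 ≤ n) (hk : 2 ≤ k) (t : ℤ) :
    t * (8 * n * k + 2 * k + 1) ≠ 6 * n + 5 := by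
  intro h
  have hlt : 6 * n + 5 < 8 * n * k + 2 * k + 1 := by nlinarith
  rcases le_or_gt t 0 with ht | ht <;> nlinarith

/-- for integers `n ≥ 1`, `r ≥ 2`, `s ≥ 1` and `k = rs`,
`s(16kn + 4k + 2) ≠ 8kn² + 8kn + 5k + n` and `s(16kn + 4k + 2) ≠ 8kn² + 4kn − 3k + n + 1`. -/
theorem arith_stmt16 (n r s k : ℤ) (hn : 1 ≤ n) (hr : 2 ≤ r) (hs : 1 ≤ s) (hk : k = r * s) :
    s * (16 * k * n + 4 * k + 2) ≠ 8 * k * n ^ 2 + 8 * k * n + 5 * k + n ∧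
    s * (16 * k * n + 4 * k + 2) ≠ 8 * k * n ^ 2 + 4 * k * n - 3 * k + n + 1 := by
  have hk2 : 2 ≤ k := by nlinarith
  constructor
  · intro h
    -- `n - 2 * s = -k * t`
    obtain ⟨t, ht⟩ : ∃ t, t = 8 * n ^ 2 + 8 * n + 5 - 16 * n * s - 4 * s := ⟨_, rfl⟩
    have hns : n - 2 * s = -(k * t) := by rw [ht]; linear_combination -h
    exact mul_ne_six_mul_add_five hn hk2 t (by linear_combination ht + (8 * n + 2) * hns)
  · intro h
    -- `n + 1 - 2 * s = k * t`
    obtain ⟨t, ht⟩ : ∃ t, t = 16 * n * s + 4 * s - 8 * n ^ 2 - 4 * n + 3 := ⟨_, rfl⟩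
    have hns : n + 1 - 2 * s = k * t := by rw [ht]; linear_combination -h
    exact mul_ne_six_mul_add_five hn hk2 t (by linear_combination ht - (8 * n + 2) * hns)
end

section
/- For all integers n ≥ 1, r ≥ 2 and s ≥ 1, setting k = rs, one has s(16kn + 16k + 2) ≠ (n+1)(12kn + 4k + 1) + 2k and s(16kn + 16k + 2) ≠ (n+1)(4kn + 4k + 1); moreover s(8kn + 8k + 1) ≠ (n+1)(12kn + 4k + 1) + 2k and s(8kn + 8k + 1) ≠ (n+1)(4kn + 4k + 1). -/
/-- If `a` and `m` are positive and `k` is at least `a`, then `a` is not a multiple of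
`4 * k * m + 1`. -/
theorem mul_four_mul_add_one_ne {a k m d : ℤ} (ha : 1 ≤ a) (hk : a ≤ k) (hm : 1 ≤ m) :
    d * (4 * k * m + 1) ≠ a := by
  intro h
  have hkm : k ≤ k * m := by nlinarith
  rcases le_or_gt d 0 with hd | hd
  · nlinarith
  · nlinarith

/-- If `m = a + k * t` with `m` positive and `k` at least `a`, then `t` is zero or `m` is at least
`a + k`. -/
theorem eq_zero_or_add_le_of_eq_add_mul {a k m t : ℤ} (hk : a ≤ k) (hk₀ : 0 ≤ k) (hm : 1 ≤ m)
    (h : m = a + k * t) : t = 0 ∨ (1 ≤ t ∧ a + k ≤ m) := by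
  rcases lt_trichotomy t 0 with ht | ht | ht
  · nlinarith
  · exact Or.inl ht
  · exact Or.inr ⟨ht, by nlinarith⟩


/-- for integers `n ≥ 1`, `r ≥ 2`, `s ≥ 1` and `k = rs`,
`s(16kn + 16k + 2)` and `s(8kn + 8k + 1)` are each distinct from both
`(n+1)(12kn + 4k + 1) + 2k` and `(n+1)(4kn + 4k + 1)`. -/
theorem arith_stmt19 (n r s k : ℤ) (hn : 1 ≤ n) (hr : 2 ≤ r) (hs : 1 ≤ s) (hk : k = r * s) :
    s * (16 * k * n + 16 * k + 2) ≠ (n + 1) * (12 * k * n + 4 * k + 1) + 2 * k ∧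
    s * (16 * k * n + 16 * k + 2) ≠ (n + 1) * (4 * k * n + 4 * k + 1) ∧
    s * (8 * k * n + 8 * k + 1) ≠ (n + 1) * (12 * k * n + 4 * k + 1) + 2 * k ∧
    s * (8 * k * n + 8 * k + 1) ≠ (n + 1) * (4 * k * n + 4 * k + 1) := by
  have hsk : 2 * s ≤ k := by nlinarith
  obtain ⟨m, rfl⟩ : ∃ m, n = m - 1 := ⟨n + 1, by ring⟩
  have hm : 2 ≤ m := by linarith
  refine ⟨fun h => ?_, fun h => ?_, fun h => ?_, fun h => ?_⟩
  · have ht : m = 2 * s + 2 * k * (m * (8 * s - 6 * m + 4) - 1) := by linear_combination -h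
    rcases eq_zero_or_add_le_of_eq_add_mul (by linarith) (by linarith) (by linarith) ht with
      h₀ | ⟨h₁, h₂⟩
    · have : m * (2 * (4 * s - 3 * m + 2)) = 1 := by linear_combination h₀
      have : 2 * (m * (4 * s - 3 * m + 2)) = 1 := by linear_combination this
      omega
    · nlinarith
  · exact mul_four_mul_add_one_ne (a := 2 * s) (d := 4 * s - m) (by linarith) hsk
      (by linarith : 1 ≤ m) (by linear_combination h)
  · have ht : m = s + k * (m * (8 * s - 12 * m + 8) - 2) := by linear_combination -h
    rcases eq_zero_or_add_le_of_eq_add_mul (by linarith) (by linarith) (by linarith) ht with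
      h₀ | ⟨h₁, h₂⟩
    · have : 4 * (m * (2 * s - 3 * m + 2)) = 2 := by linear_combination h₀
      omega
    · nlinarith
  · exact mul_four_mul_add_one_ne (a := s) (k := k) (d := 2 * s - m) hs (by linarith)
      (by linarith : 1 ≤ m) (by linear_combination h)
end
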